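/- arXiv:2501.13390 — 3 statements merged into one kernel-verified Lean document; each statement's English description precedes it below -/
import Mathlib

section
/- Let A, B ∈ ℝ^{d×m} both be semi-orthonormal and let A⊥ be a complement basis of A. Then ‖A⊥ᵀB‖_F² ≤ ‖A − B‖_F². -/
open Matrix

/-- The Frobenius norm of a real matrix. -/
noncomputable def frobNorm {d k : ℕ} (A : Matrix (Fin d) (Fin k) ℝ) : ℝ :=
  Real.sqrt (∑ i, ∑ j, A i j ^ 2)

theorem frobNorm_sq_eq_trace {d k : ℕ} (A : Matrix (Fin d) (Fin k) ℝ) :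
    frobNorm A ^ 2 = (Aᵀ * A).trace := by
  unfold frobNorm
  have h : 0 ≤ ∑ i, ∑ j, A i j ^ 2 :=
    Finset.sum_nonneg fun i _ => Finset.sum_nonneg fun j _ => sq_nonneg _
  rw [Real.sq_sqrt h, Finset.sum_comm]
  simp [Matrix.trace, Matrix.mul_apply, sq]

/-- For semi-orthonormal `A, B ∈ ℝ^{d×m}` and `A⊥` a complement basis of `A`,
`‖A⊥ᵀB‖_F² ≤ ‖A − B‖_F²`. -/
theorem sin_principal_angles_le_frob_dist
    (d m : ℕ) (hm : 0 < m) (hmd : m < d)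
    (A B : Matrix (Fin d) (Fin m) ℝ) (Ap : Matrix (Fin d) (Fin (d - m)) ℝ)
    (hA : Aᵀ * A = 1) (hB : Bᵀ * B = 1) (hAp : Apᵀ * Ap = 1) (hperp : Aᵀ * Ap = 0) :
    frobNorm (Apᵀ * B) ^ 2 ≤ frobNorm (A - B) ^ 2 := by
  have hPA : Apᵀ * A = 0 := by
    have h := congrArg Matrix.transpose hperp
    simpa [Matrix.transpose_mul] using h
  have hC : Apᵀ * B = -(Apᵀ * (A - B)) := by
    rw [Matrix.mul_sub, hPA]; simp
  generalize A - B = C at hC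
  have key : (C - Ap * (Apᵀ * C))ᵀ * (C - Ap * (Apᵀ * C))
      = Cᵀ * C - (Apᵀ * C)ᵀ * (Apᵀ * C) := by
    have h1 : Apᵀ * (C - Ap * (Apᵀ * C)) = 0 := by
      rw [Matrix.mul_sub, ← Matrix.mul_assoc Apᵀ Ap, hAp, Matrix.one_mul, sub_self]
    have h2 : (Ap * (Apᵀ * C))ᵀ * (C - Ap * (Apᵀ * C)) = 0 := by
      rw [Matrix.transpose_mul, Matrix.mul_assoc, h1, Matrix.mul_zero]
    rw [Matrix.transpose_sub, Matrix.sub_mul, h2, sub_zero, Matrix.mul_sub,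
      Matrix.transpose_mul Apᵀ C, Matrix.transpose_transpose, Matrix.mul_assoc]
  have h0 := sq_nonneg (frobNorm (C - Ap * (Apᵀ * C)))
  rw [frobNorm_sq_eq_trace, key, Matrix.trace_sub] at h0
  rw [hC, frobNorm_sq_eq_trace, frobNorm_sq_eq_trace, Matrix.transpose_neg,
    Matrix.neg_mul, Matrix.mul_neg, neg_neg]
  linarith
end

section
/- Fix integers n ≥ 1 (number of experts) and T ≥ 1 (number of rounds), loss vectors ℓ_1, …, ℓ_T with ℓ_t(i) ∈ [0,1] for all t and i, and γ ∈ (0,1). Define the exponentially weighted average (Hedge) iterates by w_1(i) = 1 for all i, p_t(i) = w_t(i)/Σ_{j=1}^n w_t(j), and w_{t+1}(i) = w_t(i)·(1−γ)^{ℓ_t(i)}. Then for every comparator expert i ∈ {1,…,n}: Σ_{t=1}^T Σ_{j=1}^n p_t(j) ℓ_t(j) ≤ (−ln(1−γ)/γ) · Σ_{t=1}^T ℓ_t(i) + ln(n)/γ. -/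
/-- Regret bound of the exponentially weighted average (Hedge) algorithm:
with `n ≥ 1` experts, `T ≥ 1` rounds, losses `ℓ_t(i) ∈ [0,1]`, and `γ ∈ (0,1)`, the iterates
`w_1(i) = 1`, `p_t(i) = w_t(i)/∑_j w_t(j)`, `w_{t+1}(i) = w_t(i)(1−γ)^{ℓ_t(i)}` satisfy, for
every comparator `i`:
`∑_t ∑_j p_t(j) ℓ_t(j) ≤ (−ln(1−γ)/γ) ∑_t ℓ_t(i) + ln(n)/γ`. -/
theorem hedge_regret_bound
    (n T : ℕ) (hn : 1 ≤ n) (hT : 1 ≤ T)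
    (ℓ : Fin T → Fin n → ℝ) (hℓ : ∀ t i, ℓ t i ∈ Set.Icc (0 : ℝ) 1)
    (γ : ℝ) (hγ : γ ∈ Set.Ioo (0 : ℝ) 1)
    (w : ℕ → Fin n → ℝ) (p : Fin T → Fin n → ℝ)
    (hw0 : ∀ i, w 0 i = 1)
    (hwsucc : ∀ (t : Fin T) (i : Fin n), w (t.val + 1) i = w t.val i * (1 - γ) ^ (ℓ t i))
    (hp : ∀ (t : Fin T) (i : Fin n), p t i = w t.val i / ∑ j, w t.val j)
    (i : Fin n) :
    ∑ t, ∑ j, p t j * ℓ t j ≤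
      (-Real.log (1 - γ) / γ) * ∑ t, ℓ t i + Real.log n / γ := by
  obtain ⟨hγ0, hγ1⟩ := hγ
  have h1 : 0 < 1 - γ := by linarith
  have hne : Nonempty (Fin n) := ⟨i⟩
  have hpos : ∀ k : ℕ, k ≤ T → ∀ j, 0 < w k j := by
    intro k
    induction k with
    | zero => intro _ j; rw [hw0]; exact one_pos
    | succ k ih =>
      intro hk j
      have h := hwsucc ⟨k, hk⟩ j
      simp only at h
      rw [h]
      exact mul_pos (ih (by omega) j) (Real.rpow_pos_of_pos h1 _)
  have hW : ∀ k : ℕ, k ≤ T → 0 < ∑ j, w k j := fun k hk =>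
    Finset.sum_pos (fun j _ => hpos k hk j) Finset.univ_nonempty
  have tele : ∀ f : ℕ → ℝ, ∑ t : Fin T, (f (t.val + 1) - f t.val) = f T - f 0 := by
    intro f
    rw [Fin.sum_univ_eq_sum_range (fun k => f (k + 1) - f k) T, Finset.sum_range_sub]
  have step : ∀ t : Fin T, γ * ∑ j, p t j * ℓ t j ≤
      -(Real.log (∑ j, w (t.val + 1) j) - Real.log (∑ j, w t.val j)) := by
    intro t
    have hWt := hW t.val t.isLt.le
    have hWs := hW (t.val + 1) t.isLt
    have e : ∑ j, p t j * ℓ t j = (∑ j, w t.val j * ℓ t j) / ∑ j, w t.val j := by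
      rw [Finset.sum_div]
      refine Finset.sum_congr rfl fun j _ => ?_
      rw [hp]; ring
    have b : ∑ j, w (t.val + 1) j ≤ ∑ j, w t.val j - γ * ∑ j, w t.val j * ℓ t j := by
      rw [Finset.mul_sum, ← Finset.sum_sub_distrib]
      refine Finset.sum_le_sum fun j _ => ?_
      have hb := rpow_one_add_le_one_add_mul_self (s := -γ) (by linarith) (hℓ t j).1 (hℓ t j).2
      rw [← sub_eq_add_neg] at hb
      rw [hwsucc]
      have := mul_le_mul_of_nonneg_left hb (hpos t.val t.isLt.le j).le
      linarith
    rw [← Real.log_div hWs.ne' hWt.ne', e]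
    have hl := Real.log_le_sub_one_of_pos (div_pos hWs hWt)
    have hd := div_le_div_of_nonneg_right b hWt.le
    rw [sub_div, div_self hWt.ne', mul_div_assoc] at hd
    linarith
  have S := Finset.sum_le_sum fun t (_ : t ∈ Finset.univ) => step t
  rw [← Finset.mul_sum, Finset.sum_neg_distrib, tele (fun k => Real.log (∑ j, w k j))] at S
  have L : Real.log (1 - γ) * ∑ t, ℓ t i = Real.log (w T i) := by
    have := tele (fun k => Real.log (w k i))
    rw [hw0, Real.log_one, sub_zero] at this
    rw [← this, Finset.mul_sum]
    refine Finset.sum_congr rfl fun t _ => ?_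
    rw [hwsucc, Real.log_mul (hpos t.val t.isLt.le i).ne' (Real.rpow_pos_of_pos h1 _).ne',
      Real.log_rpow h1]
    ring
  have M : Real.log (w T i) ≤ Real.log (∑ j, w T j) :=
    Real.log_le_log (hpos T le_rfl i)
      (Finset.single_le_sum (fun j _ => (hpos T le_rfl j).le) (Finset.mem_univ i))
  have Z : ∑ j, w 0 j = (n : ℝ) := by simp [hw0]
  simp only [Z] at S
  have : (-Real.log (1 - γ) / γ) * ∑ t, ℓ t i + Real.log n / γ =
      (-(Real.log (1 - γ) * ∑ t, ℓ t i) + Real.log n) / γ := by ring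
  rw [this, le_div_iff₀ hγ0, L]
  linarith
end

section
/- On a probability space, let Z be a {0,1}-valued random variable with P(Z = 1) = p for some p ∈ (0,1], and let θ̂ be an ℝ^d-valued random vector. Fix θ ∈ ℝ^d, α ≥ 0, δ ∈ (0,1), and suppose P(Z = 1 and ‖θ̂ − θ‖₂ > α) ≤ pδ. Let B ∈ ℝ^{d×m} be semi-orthonormal with complement basis B⊥, and let 0 ≤ C_hit ≤ C_miss be reals. Define the deterministic cost C(B) = C_hit if ‖B⊥ᵀθ‖₂ ≤ 2α and C_miss otherwise, and the random surrogate cost C̃(B) = C_hit if ‖B⊥ᵀθ̂‖₂ ≤ α and C_miss otherwise. Then the importance-weighted surrogate cost dominates the true cost in expectation up to a small error: E[C̃(B) · Z/p] ≥ C(B) − C_miss · δ. -/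
open Matrix MeasureTheory

/-- The Euclidean norm of a vector in `ℝ^k` (represented as `Fin k → ℝ`). -/
noncomputable def euclNorm {k : ℕ} (v : Fin k → ℝ) : ℝ :=
  Real.sqrt (∑ i, v i ^ 2)

theorem euclNorm_eq_norm {k : ℕ} (v : Fin k → ℝ) : euclNorm v = ‖WithLp.toLp 2 v‖ := by
  rw [EuclideanSpace.norm_eq]
  simp [euclNorm]

theorem euclNorm_sub_le {k : ℕ} (u v : Fin k → ℝ) :
    euclNorm v ≤ euclNorm u + euclNorm (u - v) := by
  simp only [euclNorm_eq_norm, WithLp.toLp_sub]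
  exact norm_le_norm_add_norm_sub _ _

theorem euclNorm_sq_dot {k : ℕ} (v : Fin k → ℝ) :
    euclNorm v = Real.sqrt (v ⬝ᵥ v) := by
  simp [euclNorm, dotProduct, sq]

theorem euclNorm_mulVec_le {d k : ℕ} (A : Matrix (Fin d) (Fin k) ℝ) (hA : Aᵀ * A = 1)
    (v : Fin d → ℝ) : euclNorm (Aᵀ.mulVec v) ≤ euclNorm v := by
  rw [euclNorm_sq_dot, euclNorm_sq_dot]
  apply Real.sqrt_le_sqrt
  have h0 : 0 ≤ (v - A.mulVec (Aᵀ.mulVec v)) ⬝ᵥ (v - A.mulVec (Aᵀ.mulVec v)) :=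
    Finset.sum_nonneg fun i _ => mul_self_nonneg _
  have h1 : v ⬝ᵥ A.mulVec (Aᵀ.mulVec v) = Aᵀ.mulVec v ⬝ᵥ Aᵀ.mulVec v := by
    rw [dotProduct_mulVec, ← mulVec_transpose]
  have h2 : A.mulVec (Aᵀ.mulVec v) ⬝ᵥ A.mulVec (Aᵀ.mulVec v)
      = Aᵀ.mulVec v ⬝ᵥ Aᵀ.mulVec v := by
    rw [dotProduct_mulVec, ← mulVec_transpose, mulVec_mulVec, hA, one_mulVec]
  rw [sub_dotProduct, dotProduct_sub, dotProduct_sub, h2, h1,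
    dotProduct_comm (A.mulVec _) v, h1] at h0
  linarith

theorem measurable_euclNorm {k : ℕ} : Measurable (euclNorm : (Fin k → ℝ) → ℝ) := by
  unfold euclNorm
  fun_prop

/-- Let `Z ∈ {0,1}` with `P(Z = 1) = p ∈ (0,1]`, let `θ̂` be a random vector
with `P(Z = 1 ∧ ‖θ̂ − θ‖₂ > α) ≤ pδ`. For a semi-orthonormal `B` with complement basis `B⊥`
and costs `0 ≤ C_hit ≤ C_miss`, define the deterministic cost `C = C_hit` if `‖B⊥ᵀθ‖₂ ≤ 2α`
else `C_miss`, and the random surrogate cost `C̃ = C_hit` if `‖B⊥ᵀθ̂‖₂ ≤ α` else `C_miss`.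
Then `E[C̃ · Z/p] ≥ C − C_miss·δ`. -/
theorem importance_weighted_surrogate_dominates
    {Ω : Type*} [MeasurableSpace Ω] (μ : Measure Ω) [IsProbabilityMeasure μ]
    (p : ℝ) (hp : p ∈ Set.Ioc (0 : ℝ) 1)
    (Z : Ω → ℝ) (hZmeas : Measurable Z) (hZ01 : ∀ ω, Z ω = 0 ∨ Z ω = 1)
    (hZp : μ {ω | Z ω = 1} = ENNReal.ofReal p)
    (d m : ℕ) (hm : 0 < m) (hmd : m < d)
    (θ : Fin d → ℝ) (θhat : Ω → Fin d → ℝ) (hθhatmeas : Measurable θhat)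
    (α δ : ℝ) (hα : 0 ≤ α) (hδ : δ ∈ Set.Ioo (0 : ℝ) 1)
    (hbad : μ {ω | Z ω = 1 ∧ α < euclNorm (θhat ω - θ)} ≤ ENNReal.ofReal (p * δ))
    (B : Matrix (Fin d) (Fin m) ℝ) (Bp : Matrix (Fin d) (Fin (d - m)) ℝ)
    (hB : Bᵀ * B = 1) (hBp : Bpᵀ * Bp = 1) (hperp : Bᵀ * Bp = 0)
    (Chit Cmiss : ℝ) (hChit : 0 ≤ Chit) (hCC : Chit ≤ Cmiss)
    (C : ℝ) (hCdef : C = if euclNorm (Bpᵀ.mulVec θ) ≤ 2 * α then Chit else Cmiss)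
    (Ctil : Ω → ℝ)
    (hCtil : ∀ ω, Ctil ω = if euclNorm (Bpᵀ.mulVec (θhat ω)) ≤ α then Chit else Cmiss) :
    C - Cmiss * δ ≤ ∫ ω, Ctil ω * Z ω / p ∂μ := by
  obtain ⟨hp0, hp1⟩ := hp
  set bad : Set Ω := {ω | Z ω = 1 ∧ α < euclNorm (θhat ω - θ)} with hbaddef
  have hmZ : MeasurableSet {ω | Z ω = 1} := hZmeas (measurableSet_singleton 1)
  have hmbad : MeasurableSet bad := by
    have hn : Measurable fun ω => euclNorm (θhat ω - θ) :=
      measurable_euclNorm.comp (hθhatmeas.sub_const θ)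
    have hs : MeasurableSet {ω | α < euclNorm (θhat ω - θ)} :=
      measurableSet_lt measurable_const hn
    exact hmZ.inter hs
  have hbadr : μ.real bad ≤ p * δ :=
    ENNReal.toReal_le_of_le_ofReal (mul_nonneg hp0.le hδ.1.le) hbad
  have hZr : μ.real {ω | Z ω = 1} = p := by
    rw [Measure.real, hZp, ENNReal.toReal_ofReal hp0.le]
  have hZind : Z = Set.indicator {ω | Z ω = 1} (fun _ => (1 : ℝ)) := by
    funext ω
    rcases hZ01 ω with h | h <;> simp [Set.indicator, h]
  have hZint : ∫ ω, Z ω ∂μ = p := by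
    rw [hZind, integral_indicator_const _ hmZ, hZr]; simp
  have hZI : Integrable Z μ := by
    rw [hZind]; exact (integrable_const _).indicator hmZ
  have hCm : 0 ≤ Cmiss := hChit.trans hCC
  have hbI : Integrable (Set.indicator bad (fun _ => (1 : ℝ))) μ :=
    (integrable_const _).indicator hmbad
  have hCle : C ≤ Cmiss := by rw [hCdef]; split_ifs <;> linarith
  have hCt0 : ∀ ω, 0 ≤ Ctil ω := fun ω => by rw [hCtil]; split_ifs <;> linarith
  have hCtm : Measurable Ctil := by
    have : Ctil = fun ω => if euclNorm (Bpᵀ.mulVec (θhat ω)) ≤ α then Chit else Cmiss :=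
      funext hCtil
    rw [this]
    refine Measurable.ite (measurableSet_le ?_ measurable_const) measurable_const
      measurable_const
    have hmv : Measurable fun v : Fin d → ℝ => Bpᵀ.mulVec v :=
      (Continuous.matrix_mulVec continuous_const continuous_id).measurable
    exact measurable_euclNorm.comp (hmv.comp hθhatmeas)
  have hCI : Integrable (fun ω => Ctil ω * Z ω / p) μ := by
    refine Integrable.div_const ?_ p
    refine hZI.bdd_mul (c := Cmiss) hCtm.aestronglyMeasurable (Filter.Eventually.of_forall fun ω => ?_)
    rw [Real.norm_of_nonneg (hCt0 ω), hCtil]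
    split_ifs <;> linarith
  have hpt : ∀ ω, (C * Z ω - Cmiss * Set.indicator bad (fun _ => (1 : ℝ)) ω) / p
      ≤ Ctil ω * Z ω / p := by
    intro ω
    refine div_le_div_of_nonneg_right ?_ hp0.le
    by_cases hb : ω ∈ bad
    · rw [Set.indicator_of_mem hb, hb.1]
      have := hCt0 ω
      linarith
    · rw [Set.indicator_of_notMem hb]
      rcases hZ01 ω with h | h
      · simp [h]
      · have hle : euclNorm (θhat ω - θ) ≤ α := by
          by_contra hc
          exact hb ⟨h, not_le.mp hc⟩
        have h1 := euclNorm_mulVec_le Bp hBp (θhat ω - θ)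
        rw [mulVec_sub] at h1
        have h2 := euclNorm_sub_le (Bpᵀ.mulVec (θhat ω)) (Bpᵀ.mulVec θ)
        have : C ≤ Ctil ω := by
          rw [hCdef, hCtil]
          split_ifs <;> linarith
        rw [h]; linarith
  have hint := integral_mono (((hZI.const_mul C).sub (hbI.const_mul Cmiss)).div_const p) hCI hpt
  refine le_trans ?_ hint
  have : ∫ ω, (C * Z ω - Cmiss * Set.indicator bad (fun _ => (1 : ℝ)) ω) / p ∂μ
      = (C * p - Cmiss * μ.real bad) / p := by
    rw [integral_div, integral_sub (hZI.const_mul C) (hbI.const_mul Cmiss),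
      integral_const_mul, integral_const_mul, hZint, integral_indicator_const _ hmbad]
    simp
  refine le_trans ?_ this.ge
  rw [le_div_iff₀ hp0]
  nlinarith [mul_le_mul_of_nonneg_left hbadr hCm]
end
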